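/- Under the hypotheses above, the kernels φ_d can moreover be chosen to be G(Γ)-invariant on pairs at syllable distance d: for every natural number d there exists a completely bounded kernel φ_d: G(Γ) × G(Γ) → ℂ with ‖φ_d‖_cb ≤ (1+129√ε)^{dκ}, with φ_d(g, e) = φ_{v₁}(g₁)⋯φ_{v_d}(g_d) for every g ≡ g₁⋯g_d with |g|_r = d, and satisfying φ_d(g, h) = φ_d(h⁻¹g, e) for every pair g, h ∈ G(Γ) with |h⁻¹g|_r = d. -/

import Mathlib

open scoped ComplexOrder commutatorElement

/-! ## Operator-norm notions -/

/-- `φ` is completely bounded (as a Herz–Schur multiplier) with cb-norm at most `C`: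
there are a Hilbert space `H` and bounded maps `α β : G → H` with
`φ (h⁻¹ * g) = ⟪α g, β h⟫` and `(sup ‖α‖) * (sup ‖β‖) ≤ C`. -/
def HasCBNormBound {G : Type} [Group G] (φ : G → ℂ) (C : ℝ) : Prop :=
  ∃ (H : Type) (_ : NormedAddCommGroup H) (_ : InnerProductSpace ℂ H)
    (α β : G → H) (Ca Cb : ℝ),
      (∀ g, ‖α g‖ ≤ Ca) ∧ (∀ h, ‖β h‖ ≤ Cb) ∧ Ca * Cb ≤ C ∧
      ∀ g h : G, φ (h⁻¹ * g) = (inner ℂ (α g) (β h) : ℂ)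

/-- A kernel `φ : G × G → ℂ` is completely bounded with cb-norm at most `C`. -/
def HasCBKernelBound {G : Type} (φ : G → G → ℂ) (C : ℝ) : Prop :=
  ∃ (H : Type) (_ : NormedAddCommGroup H) (_ : InnerProductSpace ℂ H)
    (α β : G → H) (Ca Cb : ℝ),
      (∀ g, ‖α g‖ ≤ Ca) ∧ (∀ h, ‖β h‖ ≤ Cb) ∧ Ca * Cb ≤ C ∧
      ∀ g h : G, φ g h = (inner ℂ (α g) (β h) : ℂ)

/-- A function `φ : G → ℂ` is positive definite. -/
def IsPosDefFn {G : Type} [Group G] (φ : G → ℂ) : Prop :=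
  ∀ (n : ℕ) (c : Fin n → ℂ) (x : Fin n → G),
    0 ≤ ∑ i, ∑ j, c i * (starRingEnd ℂ) (c j) * φ ((x j)⁻¹ * x i)

/-- A kernel `Ψ : G × G → ℂ` is positive definite. -/
def IsPosDefKernel {X : Type} (Ψ : X → X → ℂ) : Prop :=
  ∀ (n : ℕ) (c : Fin n → ℂ) (x : Fin n → X),
    0 ≤ ∑ i, ∑ j, c i * (starRingEnd ℂ) (c j) * Ψ (x i) (x j)

/-- A (discrete) group is amenable iff it admits an approximate identity of finitely
supported positive definite functions; we use this characterization. -/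
def AmenablePD (G : Type) [Group G] : Prop :=
  ∀ (S : Finset G) (ε : ℝ), 0 < ε →
    ∃ φ : G → ℂ, (Function.support φ).Finite ∧ IsPosDefFn φ ∧ ∀ g ∈ S, ‖φ g - 1‖ < ε

/-- A group is weakly amenable with Cowling–Haagerup constant 1: there is a net of finitely
supported completely bounded functions converging to 1 pointwise with cb-norms with
limsup at most 1. -/
def WeaklyAmenableCH1 (G : Type) [Group G] : Prop :=
  ∀ (S : Finset G) (ε : ℝ), 0 < ε →
    ∃ φ : G → ℂ, (Function.support φ).Finite ∧ HasCBNormBound φ (1 + ε) ∧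
      ∀ g ∈ S, ‖φ g - 1‖ < ε

/-! ## Graph products -/

section GraphProd

variable {V : Type} (Γ : SimpleGraph V) (G : V → Type) [∀ v, Group (G v)]

/-- The commutators `[G_v, G_w]` over the edges of `Γ`. -/
def commRels : Set (Monoid.CoprodI G) :=
  {x | ∃ (v w : V) (a : G v) (b : G w), Γ.Adj v w ∧
    x = ⁅Monoid.CoprodI.of a, Monoid.CoprodI.of b⁆}

/-- The graph product of the groups `G v` over the graph `Γ`. -/
abbrev GraphProduct :=
  Monoid.CoprodI G ⧸ Subgroup.normalClosure (commRels Γ G)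

/-- The image in the graph product of a syllable, i.e. an element of a vertex group. -/
def ofSyl (s : (v : V) × G v) : GraphProduct Γ G :=
  QuotientGroup.mk (Monoid.CoprodI.of s.2)

/-- The element of the graph product represented by a formal word of syllables. -/
def wordProd (w : List ((v : V) × G v)) : GraphProduct Γ G :=
  (w.map (ofSyl Γ G)).prod

/-- `w` is a formal word of nontrivial syllables representing `g`. -/
def IsWordOf (w : List ((v : V) × G v)) (g : GraphProduct Γ G) : Prop :=
  (∀ s ∈ w, s.2 ≠ 1) ∧ wordProd Γ G w = g

/-- The reduced word length `|g|_r`. -/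
noncomputable def redLength (g : GraphProduct Γ G) : ℕ :=
  sInf {n | ∃ w, IsWordOf Γ G w g ∧ w.length = n}

/-- `w` is a reduced word representing `g` : a representing word of nontrivial syllables
of minimal syllable length. -/
def IsReducedWordOf (w : List ((v : V) × G v)) (g : GraphProduct Γ G) : Prop :=
  IsWordOf Γ G w g ∧ ∀ w', IsWordOf Γ G w' g → w.length ≤ w'.length

/-- `κ`: the maximal number of mutually adjacent vertices of `Γ`. -/
noncomputable def kappa : ℕ :=
  sSup {n | ∃ s : Finset V, Γ.IsNClique n s}

/-- The `d`-tail of `g`: syllables appearing among the last `d` syllables of some reduced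
word representing `g`. -/
def dTail (g : GraphProduct Γ G) (d : ℕ) : Set ((v : V) × G v) :=
  {s | ∃ w, IsReducedWordOf Γ G w g ∧ s ∈ w.drop (w.length - d)}

/-- `g` begins with `G_v`. -/
def BeginsWith (g : GraphProduct Γ G) (v : V) : Prop :=
  ∃ w s, IsReducedWordOf Γ G w g ∧ w.head? = some s ∧ s.1 = v

/-- `g` ends with `G(lk(v))`: some reduced word for `g` has last syllable in a vertex
group adjacent to `v`. -/
def EndsWithLink (g : GraphProduct Γ G) (v : V) : Prop :=
  ∃ w s, IsReducedWordOf Γ G w g ∧ w.getLast? = some s ∧ Γ.Adj s.1 v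

/-- The half-space `𝔸_v` of elements beginning with `G_v`. -/
noncomputable def halfSpace (v : V) : Set (GraphProduct Γ G) :=
  {g | ∃ gv : G v, redLength Γ G (ofSyl Γ G ⟨v, gv⟩ * g) < redLength Γ G g}

/-- Left translate `k • s` of a subset of the graph product. -/
def wallTrans (k : GraphProduct Γ G) (s : Set (GraphProduct Γ G)) : Set (GraphProduct Γ G) :=
  (fun x => k * x) '' s

/-- Two walls (given by their preferred half-spaces) cross if all four intersections of
half-spaces are nonempty. -/
def Cross {X : Type} (s t : Set X) : Prop :=
  (s ∩ t).Nonempty ∧ (s ∩ tᶜ).Nonempty ∧ (sᶜ ∩ t).Nonempty ∧ (sᶜ ∩ tᶜ).Nonempty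

/-- The set of walls `𝕎 = {k𝔸_v}`. -/
noncomputable def Walls : Set (Set (GraphProduct Γ G)) :=
  {s | ∃ (k : GraphProduct Γ G) (v : V), s = wallTrans Γ G k (halfSpace Γ G v)}

/-- The wall (pseudo)distance: the number of walls separating `x` and `y`. -/
noncomputable def wallDist (x y : GraphProduct Γ G) : ℕ :=
  {s | s ∈ Walls Γ G ∧ Xor' (x ∈ s) (y ∈ s)}.ncard

end GraphProd


/-- The image in the free product `A ∗ B` of a syllable. -/
def sylEmb (A B : Type) [Group A] [Group B] : A ⊕ B → Monoid.Coprod A B :=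
  Sum.elim (fun a => Monoid.Coprod.inl a) (fun b => Monoid.Coprod.inr b)


open Monoid

theorem gp_fst_of {ι : Type} {M : ι → Type} [∀ i, Group (M i)] [DecidableEq ι]
    [∀ i, DecidableEq (M i)] (s : ι) (m : M s) (hm : m ≠ 1) :
    (CoprodI.of m • (CoprodI.Word.empty : CoprodI.Word M)).fstIdx = some s := by
  have h1 : (CoprodI.Word.empty : CoprodI.Word M).fstIdx ≠ some s := by
    simp [CoprodI.Word.fstIdx, CoprodI.Word.empty]
  rw [← CoprodI.Word.cons_eq_smul (h1 := h1) (h2 := hm)]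
  exact CoprodI.Word.fstIdx_cons _ _ _ _

theorem gp_word_right {ι : Type} {M : ι → Type} [∀ i, Group (M i)] [DecidableEq ι]
    [∀ i, DecidableEq (M i)] (w : CoprodI.Word M) (s : ι) (m : M s) :
    ∀ i, w.fstIdx = some i →
      (((w.prod * CoprodI.of m) • (CoprodI.Word.empty : CoprodI.Word M)).fstIdx = some i ∨
      ((w.prod * CoprodI.of m) • (CoprodI.Word.empty : CoprodI.Word M)).fstIdx = none) := by
  induction w using CoprodI.Word.consRecOn with
  | empty => intro i h; simp [CoprodI.Word.fstIdx, CoprodI.Word.empty] at h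
  | cons j a w h1 h2 ih =>
    intro i h
    rw [CoprodI.Word.fstIdx_cons] at h
    obtain rfl := Option.some.inj h
    rw [CoprodI.Word.prod_cons, mul_assoc, mul_smul]
    by_cases hc : ((w.prod * CoprodI.of m) • (CoprodI.Word.empty : CoprodI.Word M)).fstIdx = some j
    · cases hw : w.fstIdx with
      | some k =>
        rcases ih k hw with h' | h'
        · rw [h'] at hc; exact absurd (hw.trans hc) h1
        · rw [h'] at hc; cases hc
      | none =>
        have hwe : w = CoprodI.Word.empty := by
          apply CoprodI.Word.ext
          simpa [CoprodI.Word.fstIdx, CoprodI.Word.empty] using hw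
        subst hwe
        rw [CoprodI.Word.prod_empty, one_mul] at hc ⊢
        have hsj : s = j := by
          by_cases hm : m = 1
          · subst hm; simp [CoprodI.Word.fstIdx, CoprodI.Word.empty] at hc
          · rw [gp_fst_of _ _ hm] at hc; exact Option.some.inj hc
        subst hsj
        rw [← mul_smul, ← map_mul]
        by_cases hm : a * m = 1
        · rw [hm]; right; simp [CoprodI.Word.fstIdx, CoprodI.Word.empty]
        · left; exact gp_fst_of _ _ hm
    · left
      rw [← CoprodI.Word.cons_eq_smul (h1 := hc) (h2 := h2)]
      simp

theorem gp_head {ι : Type} {M : ι → Type} [∀ i, Group (M i)] (i : ι) :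
    ∃ head : CoprodI M → M i, (∀ a : M i, head (CoprodI.of a) = a) ∧
      ∀ (f : CoprodI M) (s : ι) (m : M s), head (f * CoprodI.of m) = head f ∨
        (s = i ∧ ∃ a : M i, f = CoprodI.of a) := by
  classical
  have h0 : (CoprodI.Word.empty : CoprodI.Word M).fstIdx ≠ some i := by
    simp [CoprodI.Word.fstIdx, CoprodI.Word.empty]
  have key : ∀ (f : CoprodI M) (a : M i), (f • (CoprodI.Word.empty : CoprodI.Word M)).fstIdx ≠ some i →
      (CoprodI.Word.equivPair i ((CoprodI.of a * f) • (CoprodI.Word.empty : CoprodI.Word M))).head = a := by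
    intro f a h
    rw [mul_smul, CoprodI.Word.equivPair_smul_same, CoprodI.Word.equivPair_eq_of_fstIdx_ne h]
    simp
  refine ⟨fun f => (CoprodI.Word.equivPair i (f • (CoprodI.Word.empty : CoprodI.Word M))).head, ?_, ?_⟩
  · intro a
    have := key 1 a (by simpa using h0)
    simpa using this
  · intro f s m
    set p := CoprodI.Word.equivPair i (f • (CoprodI.Word.empty : CoprodI.Word M)) with hp
    have hf : f = CoprodI.of p.head * p.tail.prod := by
      rw [← CoprodI.Word.prod_rcons, ← CoprodI.Word.equivPair_symm, hp, Equiv.symm_apply_apply,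
        CoprodI.Word.prod_smul, CoprodI.Word.prod_empty, mul_one]
    by_cases hc : ((p.tail.prod * CoprodI.of m) • (CoprodI.Word.empty : CoprodI.Word M)).fstIdx = some i
    · right
      cases hw : p.tail.fstIdx with
      | some k =>
        rcases gp_word_right p.tail s m k hw with h' | h'
        · rw [h'] at hc; exact absurd (hw.trans hc) p.fstIdx_ne
        · rw [h'] at hc; cases hc
      | none =>
        have hwe : p.tail = CoprodI.Word.empty := by
          apply CoprodI.Word.ext
          simpa [CoprodI.Word.fstIdx, CoprodI.Word.empty] using hw
        rw [hwe, CoprodI.Word.prod_empty] at hf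
        rw [hwe, CoprodI.Word.prod_empty, one_mul] at hc
        refine ⟨?_, p.head, by simpa using hf⟩
        by_cases hm : m = 1
        · subst hm; simp [CoprodI.Word.fstIdx, CoprodI.Word.empty] at hc
        · rw [gp_fst_of _ _ hm] at hc; exact Option.some.inj hc
    · left
      have := key _ p.head hc
      rw [← mul_assoc, ← hf] at this
      exact this

theorem gp_gns {X : Type} (P : Matrix X X ℂ) (hP : P.PosSemidef) :
    ∃ (H : Type) (_ : NormedAddCommGroup H) (_ : InnerProductSpace ℂ H) (v : X → H),
      ∀ x y, (inner ℂ (v x) (v y) : ℂ) = P x y := by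
  let c : PreInnerProductSpace.Core ℂ (X →₀ ℂ) :=
    { inner := fun f g => f.sum fun x a => g.sum fun y b => star a * P x y * b
      conj_inner_symm := by
        intro f g
        rw [Finsupp.sum_comm]
        simp only [map_finsuppSum]
        refine Finsupp.sum_congr fun x _ => Finsupp.sum_congr fun y _ => ?_
        rw [← hP.1.apply x y]
        simp
        ring
      re_inner_nonneg := by
        intro f
        exact (Complex.le_def.1 (hP.2 f)).1
      add_left := by
        intro f g h
        refine Finsupp.sum_add_index' (by simp) ?_
        intro x a b
        simp [add_mul, Finsupp.sum_add]
      smul_left := by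
        intro f g r
        change Finsupp.sum (r • f) _ = _ 
        rw [Finsupp.sum_smul_index (by simp)]
        simp [Finsupp.mul_sum, mul_assoc] }
  let i1 : SeminormedAddCommGroup (X →₀ ℂ) :=
    InnerProductSpace.Core.toSeminormedAddCommGroup (𝕜 := ℂ) (c := c)
  let i2 : InnerProductSpace ℂ (X →₀ ℂ) := InnerProductSpace.ofCore c
  refine ⟨UniformSpace.Completion (X →₀ ℂ), inferInstance, inferInstance,
    fun x => ((Finsupp.single x 1 : X →₀ ℂ) : UniformSpace.Completion (X →₀ ℂ)), ?_⟩
  intro x y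
  rw [UniformSpace.Completion.inner_coe]
  change Finsupp.sum _ _ = _
  simp

theorem gp_tensor {X J : Type} (E : J → Type) [∀ j, NormedAddCommGroup (E j)]
    [∀ j, InnerProductSpace ℂ (E j)] (ξ : ∀ j, E j) (hξ : ∀ j, ‖ξ j‖ = 1)
    (vec : ∀ j, X → E j) (hfin : ∀ x, {j | vec j x ≠ ξ j}.Finite) :
    ∃ (H : Type) (_ : NormedAddCommGroup H) (_ : InnerProductSpace ℂ H) (A : X → H),
      ∀ x y, (inner ℂ (A x) (A y) : ℂ) = ∏ᶠ j, (inner ℂ (vec j x) (vec j y) : ℂ) := by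
  classical
  have hgram : ∀ j, (Matrix.of fun x y => (inner ℂ (vec j x) (vec j y) : ℂ)).PosSemidef := by
    intro j
    refine ⟨?_, ?_⟩
    · ext x y; simp
    · intro f
      have : (f.sum fun x a => f.sum fun y b => star a * (inner ℂ (vec j x) (vec j y) : ℂ) * b)
          = inner ℂ (f.sum fun x a => a • vec j x) (f.sum fun x a => a • vec j x) := by
        simp only [Finsupp.sum]
        rw [sum_inner]
        refine Finset.sum_congr rfl fun x _ => ?_
        rw [inner_sum]
        refine Finset.sum_congr rfl fun y _ => ?_
        rw [inner_smul_left, inner_smul_right]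
        simp only [RCLike.star_def]
        ring
      simp only [Matrix.of_apply]
      rw [this, inner_self_eq_norm_sq_to_K]
      rw [← RCLike.ofReal_pow]
      exact Complex.zero_le_real.2 (sq_nonneg _)
  have hF : ∀ F : Finset J, (Matrix.of fun x y => ∏ j ∈ F, (inner ℂ (vec j x) (vec j y) : ℂ)).PosSemidef := by
    intro F
    induction F using Finset.induction_on with
    | empty =>
      refine ⟨by ext; simp, ?_⟩
      intro f
      have : (f.sum fun x a => f.sum fun y b => star a * (1 : ℂ) * b)
          = star (f.sum fun x a => a) * (f.sum fun x a => a) := by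
        simp [Finsupp.sum, Finset.sum_mul_sum]
      simp only [Matrix.of_apply, Finset.prod_empty]
      rw [this]
      exact star_mul_self_nonneg _
    | insert j F hj ih =>
      have h := (hgram j).hadamard ih
      have e : (Matrix.of fun x y => ∏ j ∈ insert j F, (inner ℂ (vec j x) (vec j y) : ℂ)) =
          (Matrix.of fun x y => (inner ℂ (vec j x) (vec j y) : ℂ)).hadamard
            (Matrix.of fun x y => ∏ j ∈ F, (inner ℂ (vec j x) (vec j y) : ℂ)) := by
        ext x y
        simp [Finset.prod_insert hj]
      rw [e]
      exact h
  refine gp_gns (Matrix.of fun x y => ∏ᶠ j, (inner ℂ (vec j x) (vec j y) : ℂ)) ⟨?_, ?_⟩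
  · ext x y
    have h := fun j => (inner_conj_symm (𝕜 := ℂ) (vec j x) (vec j y))
    set F := (hfin x).toFinset ∪ (hfin y).toFinset with hFd
    have h1 : ∀ j, j ∉ F → vec j x = ξ j ∧ vec j y = ξ j := by
      intro j hj; simpa [hFd] using hj
    have h2 : ∏ᶠ j, (inner ℂ (vec j x) (vec j y) : ℂ) = ∏ j ∈ F, inner ℂ (vec j x) (vec j y) := by
      apply finprod_eq_prod_of_mulSupport_subset
      intro j hj
      by_contra hc
      obtain ⟨a, b⟩ := h1 j hc
      exact hj (by simp [a, b, hξ j])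
    have h3 : ∏ᶠ j, (inner ℂ (vec j y) (vec j x) : ℂ) = ∏ j ∈ F, inner ℂ (vec j y) (vec j x) := by
      apply finprod_eq_prod_of_mulSupport_subset
      intro j hj
      by_contra hc
      obtain ⟨a, b⟩ := h1 j hc
      exact hj (by simp [a, b, hξ j])
    simp [h2, h3]
  · intro f
    set F := f.support.biUnion fun x => (hfin x).toFinset with hFd
    have h1 : ∀ x ∈ f.support, ∀ j, j ∉ F → vec j x = ξ j := by
      intro x hx j hj
      by_contra hc
      exact hj (Finset.mem_biUnion.2 ⟨x, hx, by simpa using hc⟩)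
    have := (hF F).2 f
    refine this.trans_eq ?_
    refine Finset.sum_congr rfl fun x hx => Finset.sum_congr rfl fun y hy => ?_
    have h2 : ∏ᶠ j, (inner ℂ (vec j x) (vec j y) : ℂ) = ∏ j ∈ F, inner ℂ (vec j x) (vec j y) := by
      apply finprod_eq_prod_of_mulSupport_subset
      intro j hj
      by_contra hc
      exact hj (by simp [h1 x hx j hc, h1 y hy j hc, hξ j])
    simp [h2]
theorem gp_scale {G : Type} [Group G] (φ : G → ℂ) (ε : ℝ)
    (hcb : ∃ C, C < 1 + ε ∧ HasCBNormBound φ C) (he : φ 1 = 1) :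
    ∃ (H : Type) (_ : NormedAddCommGroup H) (_ : InnerProductSpace ℂ H) (α β : G → H),
      (∀ s, ‖α s‖ ^ 2 ≤ 1 + ε) ∧ (∀ s, ‖β s‖ ^ 2 ≤ 1 + ε) ∧
      ∀ s t, (inner ℂ (α s) (β t) : ℂ) = φ (t⁻¹ * s) := by
  obtain ⟨C, hC, H, i1, i2, α, β, Ca, Cb, ha, hb, hab, h⟩ := hcb
  have h1 : (inner ℂ (α 1) (β 1) : ℂ) = 1 := by rw [← h]; simpa using he
  have h2 : 1 ≤ ‖α 1‖ * ‖β 1‖ := by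
    have := norm_inner_le_norm (𝕜 := ℂ) (α 1) (β 1)
    rw [h1] at this; simpa using this
  have ha0 : 0 < ‖α 1‖ := by
    rcases (norm_nonneg (α 1)).eq_or_lt with h' | h'
    · rw [← h'] at h2; linarith
    · exact h'
  have hb0 : 0 < ‖β 1‖ := by
    rcases (norm_nonneg (β 1)).eq_or_lt with h' | h'
    · rw [← h'] at h2; linarith
    · exact h'
  have hCa : 0 < Ca := ha0.trans_le (ha 1)
  have hCb : 0 < Cb := hb0.trans_le (hb 1)
  set r := Real.sqrt (Cb / Ca) with hr
  have hr0 : 0 < r := Real.sqrt_pos.2 (div_pos hCb hCa)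
  have hr2 : r ^ 2 = Cb / Ca := Real.sq_sqrt (div_pos hCb hCa).le
  refine ⟨H, i1, i2, fun s => (r : ℂ) • α s, fun s => ((r⁻¹ : ℝ) : ℂ) • β s, ?_, ?_, ?_⟩
  · intro s
    rw [norm_smul, mul_pow, Complex.norm_real, Real.norm_eq_abs, sq_abs, hr2]
    calc Cb / Ca * ‖α s‖ ^ 2 ≤ Cb / Ca * Ca ^ 2 := by
          gcongr; exact ha s
      _ = Ca * Cb := by field_simp
      _ ≤ _ := by linarith
  · intro s
    rw [norm_smul, mul_pow, Complex.norm_real, Real.norm_eq_abs, sq_abs, inv_pow, hr2]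
    calc (Cb / Ca)⁻¹ * ‖β s‖ ^ 2 ≤ (Cb / Ca)⁻¹ * Cb ^ 2 := by
          gcongr; exact hb s
      _ = Ca * Cb := by field_simp
      _ ≤ _ := by linarith
  · intro s t
    rw [inner_smul_left, inner_smul_right, ← h, Complex.conj_ofReal, ← mul_assoc,
      ← Complex.ofReal_mul, mul_inv_cancel₀ hr0.ne']
    simp

noncomputable def gpMk {H : Type} (u : H) (a b c d : ℂ) : WithLp 2 (H × EuclideanSpace ℂ (Fin 4)) :=
  WithLp.toLp 2 (u, !₂[a, b, c, d])

theorem gpMk_inner {H : Type} [NormedAddCommGroup H] [InnerProductSpace ℂ H] (u u' : H)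
    (a b c d a' b' c' d' : ℂ) :
    (inner ℂ (gpMk u a b c d) (gpMk u' a' b' c' d') : ℂ) = inner ℂ u u' +
      (star a * a' + star b * b' + star c * c' + star d * d') := by
  simp [gpMk, WithLp.prod_inner_apply, PiLp.inner_apply, Fin.sum_univ_four]
  ring

theorem gpMk_norm {H : Type} [NormedAddCommGroup H] [InnerProductSpace ℂ H] (u : H)
    (a b c d : ℂ) :
    ‖gpMk u a b c d‖ ^ 2 = ‖u‖ ^ 2 + (‖a‖ ^ 2 + ‖b‖ ^ 2 + ‖c‖ ^ 2 + ‖d‖ ^ 2) := by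
  rw [gpMk, WithLp.prod_norm_sq_eq_of_L2]
  simp [EuclideanSpace.norm_sq_eq, Fin.sum_univ_four]

theorem gp_vertex {G : Type} [Group G] (φ : G → ℂ) (ε : ℝ) (hε : 0 < ε) (hε1 : ε < 1)
    (hcb : ∃ C, C < 1 + ε ∧ HasCBNormBound φ C) (he : φ 1 = 1) :
    ∃ (H : Type) (_ : NormedAddCommGroup H) (_ : InnerProductSpace ℂ H) (α β γ : G → H) (ξ : H),
      ‖ξ‖ = 1 ∧ (∀ s, ‖γ s‖ = 1) ∧ (∀ s t, (inner ℂ (α s) (β t) : ℂ) = φ (t⁻¹ * s)) ∧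
      (∀ s, (inner ℂ (α s) ξ : ℂ) = φ s) ∧ (∀ t, (inner ℂ ξ (β t) : ℂ) = φ t⁻¹) ∧
      (∀ s, (inner ℂ (α s) (γ s) : ℂ) = 1) ∧ (∀ s, (inner ℂ (γ s) (β s) : ℂ) = 1) ∧
      (∀ s, ‖α s‖ ^ 2 ≤ 1 + 129 * Real.sqrt ε) ∧ (∀ s, ‖β s‖ ^ 2 ≤ 1 + 129 * Real.sqrt ε) := by
  obtain ⟨H, i1, i2, α, β, ha, hb, h⟩ := gp_scale φ ε hcb he
  set t := Real.sqrt ε with ht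
  have ht0 : 0 < t := Real.sqrt_pos.2 hε
  have ht2 : ε = t ^ 2 := (Real.sq_sqrt hε.le).symm
  have ht1 : t < 1 := by nlinarith
  rw [ht2] at ha hb
  have h1 : ∀ s, (inner ℂ (α s) (β s) : ℂ) = 1 := by intro s; rw [h]; simpa using he
  have hn1 : ∀ s, 1 ≤ ‖α s‖ ^ 2 * ‖β s‖ ^ 2 := by
    intro s
    have := norm_inner_le_norm (𝕜 := ℂ) (α s) (β s)
    rw [h1] at this
    simp only [norm_one] at this
    rw [← mul_pow]; exact one_le_pow₀ this
  have hn2 : ∀ s, 1 - t ^ 2 ≤ ‖β s‖ ^ 2 := by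
    intro s
    have := hn1 s
    have h3 := mul_le_mul_of_nonneg_right (ha s) (sq_nonneg ‖β s‖)
    have h4 := hb s
    nlinarith [sq_nonneg t]
  have hP : ∀ s, t / 2 ≤ (1 - (1 - t) ^ 2 * ‖β s‖ ^ 2) / 2 := by
    intro s
    have := mul_le_mul_of_nonneg_left (hb s) (sq_nonneg (1 - t))
    have h5 : 0 ≤ t * ((1 - t) * (1 - t + t ^ 2)) := by
      apply mul_nonneg ht0.le (mul_nonneg (by linarith) (by nlinarith))
    nlinarith
  set p : G → ℝ := fun s => Real.sqrt ((1 - (1 - t) ^ 2 * ‖β s‖ ^ 2) / 2) with hp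
  have hp0 : ∀ s, 0 < p s := fun s => Real.sqrt_pos.2 (by linarith [hP s])
  have hp2 : ∀ s, p s ^ 2 = (1 - (1 - t) ^ 2 * ‖β s‖ ^ 2) / 2 :=
    fun s => Real.sq_sqrt (by linarith [hP s])
  have hp3 : ∀ s, t / 2 ≤ p s ^ 2 := fun s => by rw [hp2]; exact hP s
  have hpc : ∀ s, ((p s : ℝ) : ℂ) ≠ 0 := fun s => by exact_mod_cast (hp0 s).ne'
  have hbound : ∀ (s : G) (z : ℂ) (c : ℝ), 0 ≤ c → ‖z‖ ≤ c * t → ‖z / (p s : ℂ)‖ ^ 2 ≤ 2 * c ^ 2 * t := by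
    intro s z c hc hz
    rw [norm_div, div_pow, Complex.norm_real, Real.norm_eq_abs, sq_abs,
      div_le_iff₀ (by have := hp0 s; positivity)]
    have e1 : ‖z‖ ^ 2 ≤ (c * t) ^ 2 := by gcongr
    have e2 : 2 * c ^ 2 * t * (t / 2) ≤ 2 * c ^ 2 * t * p s ^ 2 :=
      mul_le_mul_of_nonneg_left (hp3 s) (by positivity)
    nlinarith
  have hna : ∀ s, ‖α s‖ ≤ Real.sqrt (1 + t ^ 2) := fun s => Real.le_sqrt_of_sq_le (ha s)
  have hnb : ∀ s, ‖β s‖ ≤ Real.sqrt (1 + t ^ 2) := fun s => Real.le_sqrt_of_sq_le (hb s)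
  have hq : Real.sqrt (1 + t ^ 2) * Real.sqrt (1 + t ^ 2) = 1 + t ^ 2 :=
    Real.mul_self_sqrt (by positivity)
  have hφ : ∀ s, ‖φ s‖ ≤ 2 := by
    intro s
    have e := h s 1
    simp only [inv_one, one_mul] at e
    rw [← e]
    refine (norm_inner_le_norm (𝕜 := ℂ) _ _).trans ?_
    refine (mul_le_mul (hna s) (hnb 1) (norm_nonneg _) (Real.sqrt_nonneg _)).trans ?_
    rw [hq]; nlinarith
  have hδ : ‖α 1 - β 1‖ ≤ Real.sqrt 2 * t := by
    rw [← Real.sqrt_sq ht0.le, ← Real.sqrt_mul (by norm_num)]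
    apply Real.le_sqrt_of_sq_le
    rw [norm_sub_sq (𝕜 := ℂ), h1]
    have := ha 1; have := hb 1
    simp; linarith
  let y : G → ℂ := fun τ => φ τ⁻¹ - (1 - t : ℝ) * inner ℂ (β 1) (β τ)
  have hy : ∀ τ, ‖y τ‖ ≤ 4 * t := by
    intro τ
    have e : y τ = inner ℂ (α 1 - β 1) (β τ) + (t : ℂ) * inner ℂ (β 1) (β τ) := by
      have := h 1 τ
      rw [mul_one] at this
      simp only [y]
      rw [← this, inner_sub_left]
      push_cast; ring
    rw [e]
    have e1 : ‖(inner ℂ (α 1 - β 1) (β τ) : ℂ)‖ ≤ 2 * t := by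
      refine (norm_inner_le_norm (𝕜 := ℂ) _ _).trans ?_
      have : ‖β τ‖ ≤ Real.sqrt 2 := (hnb τ).trans (Real.sqrt_le_sqrt (by nlinarith))
      calc _ ≤ (Real.sqrt 2 * t) * Real.sqrt 2 := by gcongr
        _ = (Real.sqrt 2 * Real.sqrt 2) * t := by ring
        _ = 2 * t := by rw [Real.mul_self_sqrt (by norm_num)]
    have e2 : ‖(t : ℂ) * (inner ℂ (β 1) (β τ) : ℂ)‖ ≤ 2 * t := by
      rw [norm_mul, Complex.norm_real, Real.norm_eq_abs, abs_of_pos ht0, mul_comm]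
      gcongr
      refine (norm_inner_le_norm (𝕜 := ℂ) _ _).trans ?_
      refine (mul_le_mul (hnb 1) (hnb τ) (norm_nonneg _) (Real.sqrt_nonneg _)).trans ?_
      rw [hq]; nlinarith
    refine (norm_add_le _ _).trans (by linarith)
  let y' : G → ℝ := fun s => 1 - (1 - t) * ‖β s‖ ^ 2
  have hy' : ∀ s, ‖(y' s : ℂ)‖ ≤ 2 * t := by
    intro s
    rw [Complex.norm_real, Real.norm_eq_abs, abs_le]
    have e1 := mul_le_mul_of_nonneg_left (hb s) (by linarith : 0 ≤ 1 - t)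
    have e2 := mul_le_mul_of_nonneg_left (hn2 s) (by linarith : 0 ≤ 1 - t)
    simp only [y']
    constructor <;> nlinarith [mul_pos ht0 ht0]
  have hbb : ∀ s, (inner ℂ (β s) (β s) : ℂ) = ((‖β s‖ ^ 2 : ℝ) : ℂ) := by
    intro s; rw [inner_self_eq_norm_sq_to_K]; push_cast; rfl
  have hu : ∀ s, ‖((1 - t : ℝ) : ℂ) • β s‖ ^ 2 + (p s ^ 2 + p s ^ 2) = 1 := by
    intro s
    rw [norm_smul, mul_pow, Complex.norm_real, Real.norm_eq_abs, sq_abs, hp2]; ring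
  refine ⟨WithLp 2 (H × EuclideanSpace ℂ (Fin 4)), inferInstance, inferInstance,
    fun s => gpMk (α s) (star ((t : ℂ) * φ s) / (p 1 : ℂ)) 0 ((t : ℂ) / (p s : ℂ)) 0,
    fun s => gpMk (β s) 0 (y s / (p 1 : ℂ)) 0 ((y' s : ℂ) / (p s : ℂ)),
    fun s => gpMk (((1 - t : ℝ) : ℂ) • β s) 0 0 (p s) (p s),
    gpMk (((1 - t : ℝ) : ℂ) • β 1) (p 1) (p 1) 0 0, ?_, ?_, ?_, ?_, ?_, ?_, ?_, ?_, ?_⟩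
  · rw [← sq_eq_sq₀ (norm_nonneg _) zero_le_one, gpMk_norm, one_pow]
    refine Eq.trans ?_ (hu 1)
    simp
  · intro s
    rw [← sq_eq_sq₀ (norm_nonneg _) zero_le_one, gpMk_norm, one_pow]
    refine Eq.trans ?_ (hu s)
    simp
  · intro s τ
    rw [gpMk_inner, h]; simp
  · intro s
    have e := h s 1
    simp only [inv_one, one_mul] at e
    rw [gpMk_inner, inner_smul_right, e]
    have := hpc 1
    simp
    field_simp
    ring
  · intro s
    rw [gpMk_inner, inner_smul_left]
    have := hpc 1
    simp [y]
    field_simp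
    ring
  · intro s
    rw [gpMk_inner, inner_smul_right, h1]
    have := hpc s
    simp
    field_simp
    ring
  · intro s
    rw [gpMk_inner, inner_smul_left, hbb]
    have := hpc s
    simp [y']
    field_simp
    ring
  · intro s
    rw [gpMk_norm]
    have e1 := hbound 1 (star ((t : ℂ) * φ s)) 2 (by norm_num) (by
      rw [norm_star, norm_mul, Complex.norm_real, Real.norm_eq_abs, abs_of_pos ht0, mul_comm]
      gcongr; exact hφ s)
    have e2 := hbound s (t : ℂ) 1 (by norm_num) (by
      rw [Complex.norm_real, Real.norm_eq_abs, abs_of_pos ht0]; linarith)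
    have e3 := ha s
    rw [norm_zero]
    nlinarith
  · intro s
    rw [gpMk_norm]
    have e1 := hbound 1 (y s) 4 (by norm_num) (hy s)
    have e2 := hbound s (y' s) 2 (by norm_num) (hy' s)
    have e3 := hb s
    rw [norm_zero]
    nlinarith

section GP

variable {V : Type} (Γ : SimpleGraph V) (G : V → Type) [∀ v, Group (G v)]

theorem ofSyl_mul (v : V) (a b : G v) :
    ofSyl Γ G ⟨v, a * b⟩ = ofSyl Γ G ⟨v, a⟩ * ofSyl Γ G ⟨v, b⟩ := by
  simp [ofSyl]

theorem ofSyl_one (v : V) : ofSyl Γ G ⟨v, 1⟩ = 1 := by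
  simp [ofSyl]

theorem ofSyl_inv (v : V) (a : G v) : ofSyl Γ G ⟨v, a⁻¹⟩ = (ofSyl Γ G ⟨v, a⟩)⁻¹ := by
  simp [ofSyl]

theorem ofSyl_comm (v w : V) (h : Γ.Adj v w) (a : G v) (b : G w) :
    ofSyl Γ G ⟨v, a⟩ * ofSyl Γ G ⟨w, b⟩ = ofSyl Γ G ⟨w, b⟩ * ofSyl Γ G ⟨v, a⟩ := by
  have h1 : (⁅CoprodI.of a, CoprodI.of b⁆ : CoprodI G) ∈ Subgroup.normalClosure (commRels Γ G) :=
    Subgroup.subset_normalClosure ⟨v, w, a, b, h, rfl⟩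
  have h2 := (QuotientGroup.eq_one_iff (N := Subgroup.normalClosure (commRels Γ G)) _).2 h1
  rw [commutatorElement_def] at h2
  have h3 : ofSyl Γ G ⟨v, a⟩ * ofSyl Γ G ⟨w, b⟩ * (ofSyl Γ G ⟨v, a⟩)⁻¹ * (ofSyl Γ G ⟨w, b⟩)⁻¹ = 1 := h2
  rw [mul_inv_eq_one, mul_inv_eq_iff_eq_mul] at h3
  exact h3

theorem gp_exists_word (g : GraphProduct Γ G) : ∃ w, IsWordOf Γ G w g := by
  obtain ⟨x, rfl⟩ := QuotientGroup.mk_surjective g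
  induction x using CoprodI.induction_left with
  | one => exact ⟨[], by simp [IsWordOf, wordProd]⟩
  | @mul v a x ih =>
    obtain ⟨w, h1, h2⟩ := ih
    by_cases ha : a = 1
    · subst ha
      exact ⟨w, h1, by simpa using h2⟩
    · refine ⟨⟨v, a⟩ :: w, ?_, ?_⟩
      · simp only [List.mem_cons]
        rintro s (rfl | hs)
        · exact ha
        · exact h1 s hs
      · rw [QuotientGroup.mk_mul, ← h2]
        simp [wordProd, ofSyl]

theorem gp_induction {P : GraphProduct Γ G → Prop} (h1 : P 1)
    (h2 : ∀ x s, P x → P (x * ofSyl Γ G s)) (g : GraphProduct Γ G) : P g := by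
  obtain ⟨w, hw, rfl⟩ := gp_exists_word Γ G g
  clear hw
  induction w using List.reverseRecOn with
  | nil => simpa [wordProd] using h1
  | append_singleton w s ih =>
    have := h2 _ s ih
    simpa [wordProd] using this

theorem gp_lift {N : Type} [Group N] (f : ∀ v, G v →* N)
    (hf : ∀ v w (a : G v) (b : G w), Γ.Adj v w → f v a * f w b = f w b * f v a) :
    ∃ Φ : GraphProduct Γ G →* N, ∀ v (a : G v), Φ (ofSyl Γ G ⟨v, a⟩) = f v a := by
  refine ⟨QuotientGroup.lift _ (CoprodI.lift f) ?_, ?_⟩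
  · intro x hx
    have : Subgroup.normalClosure (commRels Γ G) ≤ (CoprodI.lift f).ker := by
      apply Subgroup.normalClosure_le_normal
      rintro _ ⟨v, w, a, b, h, rfl⟩
      simp only [SetLike.mem_coe, MonoidHom.mem_ker]
      rw [map_commutatorElement, CoprodI.lift_of, CoprodI.lift_of, commutatorElement_eq_one_iff_mul_comm]
      exact hf v w a b h
    exact this hx
  · intro v a
    simp [ofSyl]

/-- link subgroup -/
def gpLk (v : V) : Subgroup (GraphProduct Γ G) :=
  Subgroup.closure {x | ∃ (w : V) (a : G w), Γ.Adj v w ∧ x = ofSyl Γ G ⟨w, a⟩}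

/-- star subgroup -/
def gpSt (v : V) : Subgroup (GraphProduct Γ G) :=
  Subgroup.closure {x | ∃ (w : V) (a : G w), (w = v ∨ Γ.Adj v w) ∧ x = ofSyl Γ G ⟨w, a⟩}

theorem gpLk_le (v : V) : gpLk Γ G v ≤ gpSt Γ G v := by
  apply Subgroup.closure_mono
  rintro _ ⟨w, a, h, rfl⟩
  exact ⟨w, a, Or.inr h, rfl⟩

theorem ofSyl_mem_gpSt (v w : V) (a : G w) (h : w = v ∨ Γ.Adj v w) :
    ofSyl Γ G ⟨w, a⟩ ∈ gpSt Γ G v := Subgroup.subset_closure ⟨w, a, h, rfl⟩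

theorem gpLk_comm (v : V) (a : G v) (l : GraphProduct Γ G) (hl : l ∈ gpLk Γ G v) :
    l * ofSyl Γ G ⟨v, a⟩ * l⁻¹ = ofSyl Γ G ⟨v, a⟩ := by
  have h : gpLk Γ G v ≤ Subgroup.centralizer {ofSyl Γ G ⟨v, a⟩} := by
    apply (Subgroup.closure_le _).2
    rintro _ ⟨w, b, h, rfl⟩
    rw [SetLike.mem_coe, Subgroup.mem_centralizer_iff]
    rintro _ rfl
    exact ofSyl_comm Γ G v w h a b
  have h2 := Subgroup.mem_centralizer_iff.1 (h hl) _ rfl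
  rw [mul_inv_eq_iff_eq_mul]
  exact h2.symm

/-- permutation action on a free product of copies of one group -/
noncomputable def gpPerm {K S A : Type} [Group K] [MulAction K S] [Group A] :
    MulDistribMulAction K (CoprodI (fun _ : S => A)) where
  smul k f := CoprodI.lift (fun s => (CoprodI.of (M := fun _ : S => A) (i := k • s))) f
  one_smul f := by
    change CoprodI.lift _ f = f
    have : CoprodI.lift (fun s => (CoprodI.of (M := fun _ : S => A) (i := (1 : K) • s))) =
        MonoidHom.id _ := by
      apply CoprodI.ext_hom
      intro i
      ext a
      simp
    rw [this]; rfl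
  mul_smul k k' f := by
    change CoprodI.lift _ f = CoprodI.lift _ (CoprodI.lift _ f)
    rw [← MonoidHom.comp_apply]
    congr 1
    apply CoprodI.ext_hom
    intro i
    ext a
    simp [mul_smul]
  smul_mul k f f' := map_mul (CoprodI.lift _) f f'
  smul_one k := map_one (CoprodI.lift _)

theorem gp_proj (v : V) : ∃ p : GraphProduct Γ G → G v,
    (∀ z ∈ gpSt Γ G v, ∀ u : G v, p (z * ofSyl Γ G ⟨v, u⟩) = p z * u) ∧
    (∀ g w (u : G w), w ≠ v → p (g * ofSyl Γ G ⟨w, u⟩) = p g) ∧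
    (∀ g, g ∉ gpSt Γ G v → ∀ u : G v, p (g * ofSyl Γ G ⟨v, u⟩) = p g) := by
  classical
  let S := GraphProduct Γ G ⧸ gpLk Γ G v
  let F := CoprodI (fun _ : S => G v)
  let act : MulDistribMulAction (GraphProduct Γ G) F := gpPerm
  have hact : ∀ (k : GraphProduct Γ G) (s : S) (a : G v),
      k • (CoprodI.of (M := fun _ : S => G v) (i := s) a : F) =
        CoprodI.of (M := fun _ : S => G v) (i := k • s) a := by
    intro k s a
    exact CoprodI.lift_of _ _
  let s0 : S := ((1 : GraphProduct Γ G) : S)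
  have hs0 : ∀ k : GraphProduct Γ G, k • s0 = s0 ↔ k ∈ gpLk Γ G v := by
    intro k
    have : k • s0 = ((k : GraphProduct Γ G) : S) := by
      change (((k • (1 : GraphProduct Γ G)) : GraphProduct Γ G) : S) = _
      rw [smul_eq_mul, mul_one]
    rw [this, eq_comm]
    change ((1 : GraphProduct Γ G) : S) = (k : S) ↔ _
    rw [QuotientGroup.eq]; simp
  let θ := MulDistribMulAction.toMulAut (GraphProduct Γ G) F
  have hθ : ∀ k (f : F), θ k f = k • f := fun _ _ => rfl
  let e : G v →* F := CoprodI.of (M := fun _ : S => G v) (i := s0)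
  let fam : ∀ w, G w →* (F ⋊[θ] GraphProduct Γ G) := fun w =>
    if h : w = v then (SemidirectProduct.inl.comp e).comp (h ▸ MonoidHom.id (G w) : G w →* G v)
    else SemidirectProduct.inr.comp
      { toFun := fun a => ofSyl Γ G ⟨w, a⟩, map_one' := ofSyl_one Γ G w, map_mul' := ofSyl_mul Γ G w }
  have famv : ∀ a, fam v a = SemidirectProduct.inl (e a) := by
    intro a; simp [fam]
  have famw : ∀ w, w ≠ v → ∀ a, fam w a = SemidirectProduct.inr (ofSyl Γ G ⟨w, a⟩) := by
    intro w hw a; simp [fam, hw]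
  have hvw : ∀ w, Γ.Adj v w → ∀ (a : G v) (b : G w), fam v a * fam w b = fam w b * fam v a := by
    intro w hw a b
    have hl : ofSyl Γ G ⟨w, b⟩ ∈ gpLk Γ G v := Subgroup.subset_closure ⟨w, b, hw, rfl⟩
    rw [famv, famw w hw.ne']
    ext
    · simp only [SemidirectProduct.mul_left, SemidirectProduct.left_inl, SemidirectProduct.right_inl,
        SemidirectProduct.left_inr, SemidirectProduct.right_inr, map_one, one_mul, mul_one, hθ, e, hact]
      rw [(hs0 _).2 hl]
    · simp
  obtain ⟨Φ, hΦ⟩ := gp_lift Γ G fam (by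
    intro w w' a b h
    by_cases h1 : w = v
    · subst h1; exact hvw w' h a b
    · by_cases h2 : w' = v
      · subst h2; exact (hvw w h.symm b a).symm
      · rw [famw w h1, famw w' h2, ← map_mul, ← map_mul, ofSyl_comm Γ G w w' h])
  obtain ⟨head, hh1, hh2⟩ := gp_head (M := fun _ : S => G v) s0
  have hleft_v : ∀ g (u : G v), (Φ (g * ofSyl Γ G ⟨v, u⟩)).left = (Φ g).left *
      CoprodI.of (M := fun _ : S => G v) (i := (Φ g).right • s0) u := by
    intro g u
    rw [map_mul, hΦ, famv, SemidirectProduct.mul_left, SemidirectProduct.left_inl, hθ, hact]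
  -- star elements
  have hst : ∀ z ∈ gpSt Γ G v, ∃ a : G v, (Φ z).left = e a ∧ (Φ z).right ∈ gpLk Γ G v := by
    intro z hz
    induction hz using Subgroup.closure_induction with
    | mem x hx =>
      obtain ⟨w, a, hw, rfl⟩ := hx
      by_cases h : w = v
      · subst h
        exact ⟨a, by rw [hΦ, famv]; simp, by rw [hΦ, famv]; simp [one_mem]⟩
      · refine ⟨1, by rw [hΦ, famw w h]; simp, ?_⟩
        rw [hΦ, famw w h]
        exact Subgroup.subset_closure ⟨w, a, hw.resolve_left h, rfl⟩
    | one => exact ⟨1, by simp, by simp [one_mem]⟩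
    | mul x y _ _ hx hy =>
      obtain ⟨a, ha, ha'⟩ := hx
      obtain ⟨b, hb, hb'⟩ := hy
      refine ⟨a * b, ?_, ?_⟩
      · rw [map_mul, SemidirectProduct.mul_left, ha, hb, hθ]
        simp only [e, hact]
        rw [(hs0 _).2 ha', map_mul]
      · rw [map_mul, SemidirectProduct.mul_right]
        exact mul_mem ha' hb'
    | inv x _ hx =>
      obtain ⟨a, ha, ha'⟩ := hx
      refine ⟨a⁻¹, ?_, ?_⟩
      · rw [map_inv, SemidirectProduct.inv_left, ha, hθ, ← map_inv]
        simp only [e, hact]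
        rw [(hs0 _).2 (inv_mem ha')]
      · rw [map_inv, SemidirectProduct.inv_right]
        exact inv_mem ha'
  -- reconstruction
  let κ : F →* GraphProduct Γ G := CoprodI.lift (fun s : S =>
    { toFun := fun a => s.out * ofSyl Γ G ⟨v, a⟩ * s.out⁻¹
      map_one' := by rw [ofSyl_one]; simp
      map_mul' := by intro a b; rw [ofSyl_mul]; group })
  have hκ : ∀ (k : GraphProduct Γ G) (a : G v),
      κ (CoprodI.of (M := fun _ : S => G v) (i := k • s0) a) = k * ofSyl Γ G ⟨v, a⟩ * k⁻¹ := by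
    intro k a
    have h1 : κ (CoprodI.of (M := fun _ : S => G v) (i := k • s0) a) =
      (k • s0).out * ofSyl Γ G ⟨v, a⟩ * (k • s0).out⁻¹ := CoprodI.lift_of _ _
    have h2 : k • s0 = ((k : GraphProduct Γ G) : S) := by
      change (((k • (1 : GraphProduct Γ G)) : GraphProduct Γ G) : S) = _
      rw [smul_eq_mul, mul_one]
    rw [h1, h2]
    obtain ⟨l, hl⟩ := QuotientGroup.mk_out_eq_mul (gpLk Γ G v) k
    have h3 := gpLk_comm Γ G v a l l.2
    change Quotient.out (k : S) = _ at hl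
    rw [hl]
    calc _ = k * (l * ofSyl Γ G ⟨v, a⟩ * (l : GraphProduct Γ G)⁻¹) * k⁻¹ := by group
      _ = _ := by rw [h3]
  have hrec : ∀ g, κ (Φ g).left * (Φ g).right = g := by
    intro g
    induction g using gp_induction Γ G with
    | h1 => simp
    | h2 x s ih =>
      obtain ⟨w, u⟩ := s
      by_cases h : w = v
      · subst h
        rw [hleft_v, map_mul, map_mul, hκ, hΦ, famv, SemidirectProduct.mul_right,
          SemidirectProduct.right_inl]
        conv_rhs => rw [← ih]
        group
      · rw [map_mul, hΦ, famw w h, SemidirectProduct.mul_right, SemidirectProduct.mul_left,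
          SemidirectProduct.right_inr, SemidirectProduct.left_inr, map_one, mul_one, ← mul_assoc, ih]
  refine ⟨fun g => head (Φ g).left, ?_, ?_, ?_⟩
  · intro z hz u
    obtain ⟨a, ha, ha'⟩ := hst z hz
    simp only
    rw [hleft_v, ha, (hs0 _).2 ha']
    simp only [e]
    rw [← map_mul, hh1, hh1]
  · intro g w u hw
    simp only
    rw [map_mul, hΦ, famw w hw, SemidirectProduct.mul_left, SemidirectProduct.left_inr, map_one, mul_one]
  · intro g hg u
    simp only
    rw [hleft_v]
    rcases hh2 (Φ g).left ((Φ g).right • s0) u with h | ⟨h, a, ha⟩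
    · exact h
    · exfalso
      apply hg
      rw [← hrec g, ha]
      refine mul_mem ?_ (gpLk_le Γ G v ((hs0 _).1 h))
      have := hκ 1 a
      rw [one_smul] at this
      rw [this]
      simpa using ofSyl_mem_gpSt Γ G v v a (Or.inl rfl)

end GP

section GP5

variable {V : Type} (Γ : SimpleGraph V) (G : V → Type) [∀ v, Group (G v)]

/-- hyperplanes -/
abbrev GpHyp := (v : V) × (GraphProduct Γ G ⧸ gpSt Γ G v)

/-- hyperplane crossed by a letter of type `v` at `x` -/
def gpJ (x : GraphProduct Γ G) (v : V) : GpHyp Γ G := ⟨v, QuotientGroup.mk x⟩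

/-- sector coordinate -/
noncomputable def gpS (J : GpHyp Γ G) (g : GraphProduct Γ G) : G J.1 :=
  ((gp_proj Γ G J.1).choose (J.2.out⁻¹))⁻¹ * (gp_proj Γ G J.1).choose (J.2.out⁻¹ * g)

theorem gpS_one (J : GpHyp Γ G) : gpS Γ G J 1 = 1 := by
  simp [gpS]

theorem gpS_same (x : GraphProduct Γ G) (v : V) (u : G v) :
    gpS Γ G (gpJ Γ G x v) (x * ofSyl Γ G ⟨v, u⟩) =
      @HMul.hMul (G v) (G v) (G v) _ (gpS Γ G (gpJ Γ G x v) x) u := by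
  have h := (gp_proj Γ G v).choose_spec.1
  have hm : (Quotient.out (QuotientGroup.mk x : GraphProduct Γ G ⧸ gpSt Γ G v))⁻¹ * x ∈ gpSt Γ G v := by
    rw [← QuotientGroup.eq]
    exact QuotientGroup.out_eq' _
  have h' := h _ hm u
  rw [mul_assoc] at h'
  exact (congrArg (fun t : G v => ((gp_proj Γ G v).choose
    ((Quotient.out (QuotientGroup.mk x : GraphProduct Γ G ⧸ gpSt Γ G v))⁻¹))⁻¹ * t) h').trans
    (mul_assoc _ _ _).symm

theorem gpS_ne (x : GraphProduct Γ G) (c : (v : V) × G v) (J : GpHyp Γ G) (hJ : J ≠ gpJ Γ G x c.1) :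
    gpS Γ G J (x * ofSyl Γ G c) = gpS Γ G J x := by
  obtain ⟨w, u⟩ := c
  obtain ⟨v, k⟩ := J
  have h2 := (gp_proj Γ G v).choose_spec.2.1
  have h3 := (gp_proj Γ G v).choose_spec.2.2
  simp only [gpS]
  rw [← mul_assoc]
  by_cases hw : w = v
  · subst hw
    rw [h3]
    intro hm
    apply hJ
    rw [← QuotientGroup.eq] at hm
    rw [gpJ, ← hm]
    congr 1
    exact (QuotientGroup.out_eq' _).symm
  · rw [h2 _ _ _ hw]

theorem gpJ_mul (x z : GraphProduct Γ G) (v : V) (hz : z ∈ gpSt Γ G v) :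
    gpJ Γ G (x * z) v = gpJ Γ G x v := by
  simp only [gpJ]
  congr 1
  rw [eq_comm, QuotientGroup.eq]
  simpa using hz

theorem gpJ_out (J : GpHyp Γ G) : ∃ x, J = gpJ Γ G x J.1 := by
  obtain ⟨v, k⟩ := J
  obtain ⟨x, rfl⟩ := QuotientGroup.mk_surjective k
  exact ⟨x, rfl⟩

theorem gpJ_eq (x y : GraphProduct Γ G) (v : V) (h : gpJ Γ G x v = gpJ Γ G y v) :
    ∃ z ∈ gpSt Γ G v, y = x * z := by
  simp only [gpJ, Sigma.mk.injEq, heq_eq_eq, true_and] at h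
  rw [QuotientGroup.eq] at h
  exact ⟨_, h, by simp⟩

theorem gpS_const (J : GpHyp Γ G) (v : V) (hadj : ¬ Γ.Adj v J.1) (z : GraphProduct Γ G)
    (hz : z ∈ gpSt Γ G v) : ∀ x, J ≠ gpJ Γ G x v →
    gpS Γ G J (x * z) = gpS Γ G J x := by
  induction hz using Subgroup.closure_induction with
  | mem z hz =>
    obtain ⟨w, a, hw, rfl⟩ := hz
    intro x hx
    apply gpS_ne
    rintro h
    rcases hw with rfl | hw
    · exact hx h
    · apply hadj
      rw [h]; exact hw
  | one => intro x _; simp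
  | mul y z hy hz ihy ihz =>
    intro x hx
    rw [← mul_assoc, ihz _ (by rwa [gpJ_mul Γ G x y v hy]), ihy x hx]
  | inv y hy ihy =>
    intro x hx
    have := ihy (x * y⁻¹) (by rwa [gpJ_mul Γ G x y⁻¹ v (inv_mem hy)])
    rw [← this]; simp

theorem gp_nested (J J' : GpHyp Γ G) (hne : J ≠ J') (hadj : ¬ Γ.Adj J.1 J'.1) :
    ∃ x0 y0, ∀ g, gpS Γ G J g = x0 ∨ gpS Γ G J' g = y0 := by
  obtain ⟨k, hk⟩ := gpJ_out Γ G J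
  obtain ⟨k', hk'⟩ := gpJ_out Γ G J'
  refine ⟨gpS Γ G J k', gpS Γ G J' k, ?_⟩
  have key : ∀ z, gpS Γ G J (k' * z) = gpS Γ G J k' ∨ gpS Γ G J' (k' * z) = gpS Γ G J' k := by
    intro z
    induction z using gp_induction Γ G with
    | h1 => left; simp
    | h2 z c ih =>
      by_cases h1 : J = gpJ Γ G (k' * z) c.1
      · right
        have hc : J.1 = c.1 := by rw [h1]; rfl
        have h1' : gpJ Γ G k J.1 = gpJ Γ G (k' * z) J.1 := by rw [← hk, hc]; exact h1
        obtain ⟨y, hy, hy'⟩ := gpJ_eq Γ G _ _ _ h1'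
        have hcm : ofSyl Γ G c ∈ gpSt Γ G J.1 := ofSyl_mem_gpSt Γ G J.1 c.1 c.2 (Or.inl hc.symm)
        rw [← mul_assoc, hy', mul_assoc]
        exact gpS_const Γ G J' J.1 hadj _ (mul_mem hy hcm) k (by rw [← hk]; exact hne.symm)
      · by_cases h2 : J' = gpJ Γ G (k' * z) c.1
        · left
          have hc : J'.1 = c.1 := by rw [h2]; rfl
          have h1' : gpJ Γ G k' J'.1 = gpJ Γ G (k' * z) J'.1 := by rw [← hk', hc]; exact h2
          obtain ⟨y, hy, hy'⟩ := gpJ_eq Γ G _ _ _ h1'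
          have hcm : ofSyl Γ G c ∈ gpSt Γ G J'.1 := ofSyl_mem_gpSt Γ G J'.1 c.1 c.2 (Or.inl hc.symm)
          rw [← mul_assoc, hy', mul_assoc]
          exact gpS_const Γ G J J'.1 (fun h => hadj h.symm) _ (mul_mem hy hcm) k'
            (by rw [← hk']; exact hne)
        · rw [← mul_assoc, gpS_ne Γ G _ c J h1, gpS_ne Γ G _ c J' h2]
          exact ih
  intro g
  have := key (k'⁻¹ * g)
  simpa using this

/-- `J` separates `g` from some point at distance at most `n` -/
def gpReach (n : ℕ) (g : GraphProduct Γ G) (J : GpHyp Γ G) : Prop :=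
  ∃ w : List ((v : V) × G v), w.length ≤ n ∧ gpS Γ G J (g * wordProd Γ G w) ≠ gpS Γ G J g

theorem wordProd_append (p q : List ((v : V) × G v)) :
    wordProd Γ G (p ++ q) = wordProd Γ G p * wordProd Γ G q := by
  simp [wordProd]

theorem wordProd_cons (c : (v : V) × G v) (q : List ((v : V) × G v)) :
    wordProd Γ G (c :: q) = ofSyl Γ G c * wordProd Γ G q := by
  simp [wordProd]

theorem wordProd_nil : wordProd Γ G [] = 1 := by
  simp [wordProd]

theorem gp_level_aux (J J' : GpHyp Γ G) (hne : J ≠ J') (g : GraphProduct Γ G)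
    (h : ∀ x, gpS Γ G J x = 1 ∨ gpS Γ G J' x = gpS Γ G J' g) (hg : gpS Γ G J g ≠ 1) (n : ℕ)
    (hn : gpReach Γ G n g J') : ∃ m < n, gpReach Γ G m g J := by
  obtain ⟨w, hw, hw'⟩ := hn
  suffices h : ∃ m < w.length, gpReach Γ G m g J by
    obtain ⟨m, hm, h⟩ := h
    exact ⟨m, by omega, h⟩
  clear hw
  induction w using List.reverseRecOn with
  | nil => simp [wordProd_nil] at hw'
  | append_singleton w c ih =>
    by_cases h0 : gpS Γ G J' (g * wordProd Γ G w) = gpS Γ G J' g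
    · refine ⟨w.length, by simp, w, le_rfl, ?_⟩
      have e : g * wordProd Γ G (w ++ [c]) = g * wordProd Γ G w * ofSyl Γ G c := by
        rw [wordProd_append, wordProd_cons, wordProd_nil, mul_one, mul_assoc]
      rw [e] at hw'
      have h1 : J' = gpJ Γ G (g * wordProd Γ G w) c.1 := by
        by_contra hc
        rw [gpS_ne Γ G _ c J' hc] at hw'
        exact hw' h0
      rw [← gpS_ne Γ G _ c J (by rw [← h1]; exact hne)]
      rw [(h (g * wordProd Γ G w * ofSyl Γ G c)).resolve_right hw']
      exact hg.symm
    · obtain ⟨m, hm, h⟩ := ih h0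
      exact ⟨m, by simp; omega, h⟩

theorem gp_level (J J' : GpHyp Γ G) (hne : J ≠ J') (hadj : ¬ Γ.Adj J.1 J'.1)
    (g : GraphProduct Γ G) (hg : gpS Γ G J g ≠ 1) (hg' : gpS Γ G J' g ≠ 1) :
    (∀ n, gpReach Γ G n g J' → ∃ m < n, gpReach Γ G m g J) ∨
    (∀ n, gpReach Γ G n g J → ∃ m < n, gpReach Γ G m g J') := by
  obtain ⟨x0, y0, h⟩ := gp_nested Γ G J J' hne hadj
  have h1 := h 1
  rw [gpS_one, gpS_one] at h1
  rcases h1 with rfl | rfl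
  · left
    have := (h g).resolve_left hg
    subst this
    exact gp_level_aux Γ G J J' hne g h hg
  · right
    have := (h g).resolve_right hg'
    subst this
    exact gp_level_aux Γ G J' J hne.symm g (fun x => (h x).symm) hg'

/-- hyperplanes crossed by a path -/
def gpCross : GraphProduct Γ G → List ((v : V) × G v) → List (GpHyp Γ G)
  | _, [] => []
  | x, c :: w => gpJ Γ G x c.1 :: gpCross (x * ofSyl Γ G c) w

theorem gpCross_append (p q : List ((v : V) × G v)) : ∀ x,
    gpCross Γ G x (p ++ q) = gpCross Γ G x p ++ gpCross Γ G (x * wordProd Γ G p) q := by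
  induction p with
  | nil => intro x; simp [gpCross, wordProd_nil]
  | cons c p ih => intro x; simp [gpCross, ih, wordProd_cons, mul_assoc]

theorem gpS_not_cross (J : GpHyp Γ G) (w : List ((v : V) × G v)) : ∀ x,
    J ∉ gpCross Γ G x w → gpS Γ G J (x * wordProd Γ G w) = gpS Γ G J x := by
  induction w with
  | nil => intro x _; simp [wordProd_nil]
  | cons c w ih =>
    intro x hx
    simp only [gpCross, List.mem_cons, not_or] at hx
    rw [wordProd_cons, ← mul_assoc, ih _ hx.2, gpS_ne Γ G x c J hx.1]

theorem gpS_split (p q : List ((v : V) × G v)) (c : (v : V) × G v) (x : GraphProduct Γ G)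
    (hnd : (gpCross Γ G x (p ++ c :: q)).Nodup) :
    gpS Γ G (gpJ Γ G (x * wordProd Γ G p) c.1) (x * wordProd Γ G (p ++ c :: q)) =
      @HMul.hMul (G c.1) (G c.1) (G c.1) _ (gpS Γ G (gpJ Γ G (x * wordProd Γ G p) c.1) x) c.2 := by
  rw [gpCross_append, gpCross, List.nodup_append, List.nodup_cons] at hnd
  obtain ⟨h1, ⟨h2, h3⟩, h4⟩ := hnd
  rw [wordProd_append, wordProd_cons, ← mul_assoc, ← mul_assoc, gpS_not_cross Γ G _ q _ h2]
  obtain ⟨v, u⟩ := c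
  rw [gpS_same]
  rw [gpS_not_cross Γ G _ p]
  intro hm
  exact h4 _ hm _ (List.mem_cons_self) rfl

theorem gpCross_first (J : GpHyp Γ G) (w : List ((v : V) × G v)) : ∀ x,
    J ∈ gpCross Γ G x w → ∃ p b q, w = p ++ b :: q ∧ J ∉ gpCross Γ G x p ∧
      J = gpJ Γ G (x * wordProd Γ G p) b.1 := by
  induction w with
  | nil => intro x hx; simp [gpCross] at hx
  | cons c w ih =>
    intro x hx
    by_cases h : J = gpJ Γ G x c.1
    · exact ⟨[], c, w, rfl, by simp [gpCross], by simpa [wordProd_nil] using h⟩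
    · simp only [gpCross, List.mem_cons, h, false_or] at hx
      obtain ⟨p, b, q, rfl, h2, h3⟩ := ih _ hx
      refine ⟨c :: p, b, q, rfl, ?_, ?_⟩
      · simp [gpCross, h, h2]
      · rw [wordProd_cons, ← mul_assoc]; exact h3

theorem gpRed_append (p q : List ((v : V) × G v)) (g : GraphProduct Γ G)
    (h : IsReducedWordOf Γ G (p ++ q) g) :
    IsReducedWordOf Γ G p (wordProd Γ G p) ∧ IsReducedWordOf Γ G q (wordProd Γ G q) := by
  obtain ⟨⟨h1, h2⟩, h3⟩ := h
  refine ⟨⟨⟨fun s hs => h1 s (by simp [hs]), rfl⟩, ?_⟩, ⟨⟨fun s hs => h1 s (by simp [hs]), rfl⟩, ?_⟩⟩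
  · rintro w ⟨hw1, hw2⟩
    have := h3 (w ++ q) ⟨?_, ?_⟩
    · simp at this; omega
    · intro s hs
      rcases List.mem_append.1 hs with hs | hs
      · exact hw1 s hs
      · exact h1 s (by simp [hs])
    · rw [wordProd_append, hw2, ← wordProd_append, h2]
  · rintro w ⟨hw1, hw2⟩
    have := h3 (p ++ w) ⟨?_, ?_⟩
    · simp at this; omega
    · intro s hs
      rcases List.mem_append.1 hs with hs | hs
      · exact h1 s (by simp [hs])
      · exact hw1 s hs
    · rw [wordProd_append, hw2, ← wordProd_append, h2]

theorem wordProd_mem_st (v : V) (p : List ((v : V) × G v))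
    (hp : ∀ c ∈ p, c.1 = v ∨ Γ.Adj v c.1) : wordProd Γ G p ∈ gpSt Γ G v := by
  apply Subgroup.list_prod_mem
  intro x hx
  obtain ⟨c, hc, rfl⟩ := List.mem_map.1 hx
  exact ofSyl_mem_gpSt Γ G v c.1 c.2 (hp c hc)

theorem wordProd_comm (v : V) (u : G v) (p : List ((v : V) × G v))
    (hp : ∀ c ∈ p, Γ.Adj v c.1) :
    wordProd Γ G p * ofSyl Γ G ⟨v, u⟩ = ofSyl Γ G ⟨v, u⟩ * wordProd Γ G p := by
  have : wordProd Γ G p ∈ gpLk Γ G v := by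
    apply Subgroup.list_prod_mem
    intro x hx
    obtain ⟨c, hc, rfl⟩ := List.mem_map.1 hx
    exact Subgroup.subset_closure ⟨c.1, c.2, hp c hc, rfl⟩
  have h := gpLk_comm Γ G v u _ this
  rwa [mul_inv_eq_iff_eq_mul] at h

theorem gpCross_nodup (w : List ((v : V) × G v)) : ∀ x,
    IsReducedWordOf Γ G w (wordProd Γ G w) → (gpCross Γ G x w).Nodup := by
  induction w with
  | nil => intro x _; simp [gpCross]
  | cons a w ih =>
    intro x hred
    have hw := (gpRed_append Γ G [a] w _ hred).2
    rw [gpCross, List.nodup_cons]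
    refine ⟨?_, ih _ hw⟩
    intro hmem
    obtain ⟨p, b, q, rfl, hp, hb⟩ := gpCross_first Γ G _ _ _ hmem
    obtain ⟨v, au⟩ := a
    obtain ⟨v', bu⟩ := b
    have hvv : v = v' := congrArg Sigma.fst hb
    subst hvv
    simp only at *
    set y := x * ofSyl Γ G ⟨v, au⟩ with hy
    have hxy : gpJ Γ G y v = gpJ Γ G x v :=
      gpJ_mul Γ G x _ v (ofSyl_mem_gpSt Γ G v v au (Or.inl rfl))
    have hpst : wordProd Γ G p ∈ gpSt Γ G v := by
      rw [← hxy] at hb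
      obtain ⟨z, hz, hz'⟩ := gpJ_eq Γ G _ _ _ hb
      rw [mul_left_cancel hz']
      exact hz
    have hpred := (gpRed_append Γ G p _ _ hw).1
    have hnd : (gpCross Γ G y p).Nodup := by
      have := ih y hw
      rw [gpCross_append, List.nodup_append] at this
      exact this.1
    have h1 : ∀ c ∈ p, c.1 = v ∨ Γ.Adj v c.1 := by
      intro c hc
      by_contra hcon
      rw [not_or] at hcon
      have hc1 := hpred.1.1 c hc
      obtain ⟨p1, p2, rfl⟩ := List.append_of_mem hc
      have h := gpS_split Γ G p1 p2 c y hnd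
      have h' := gpS_const Γ G (gpJ Γ G (y * wordProd Γ G p1) c.1) v hcon.2 _ hpst y
        (fun hh => hcon.1 (congrArg Sigma.fst hh))
      rw [h'] at h
      exact hc1 (left_eq_mul.1 h)
    have h2 : ∀ c ∈ p, Γ.Adj v c.1 := by
      intro c hc
      refine (h1 c hc).resolve_left ?_
      intro hcv
      obtain ⟨p1, p2, rfl⟩ := List.append_of_mem hc
      apply hp
      rw [gpCross_append, gpCross, List.mem_append, List.mem_cons]
      right; left
      rw [hcv, gpJ_mul Γ G y _ v (wordProd_mem_st Γ G v p1 (fun c hc => h1 c (by simp [hc]))), hxy]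
    have hr : IsReducedWordOf Γ G (⟨v, au⟩ :: (p ++ [⟨v, bu⟩]))
        (wordProd Γ G (⟨v, au⟩ :: (p ++ [⟨v, bu⟩]))) := by
      refine (gpRed_append Γ G (⟨v, au⟩ :: (p ++ [⟨v, bu⟩])) q
        (wordProd Γ G (⟨v, au⟩ :: (p ++ ⟨v, bu⟩ :: q))) ?_).1
      simpa using hred
    have e : wordProd Γ G (⟨v, au⟩ :: (p ++ [⟨v, bu⟩])) =
        ofSyl Γ G ⟨v, au * bu⟩ * wordProd Γ G p := by
      rw [wordProd_cons, wordProd_append, wordProd_cons, wordProd_nil, mul_one,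
        wordProd_comm Γ G v bu p h2, ofSyl_mul, mul_assoc]
    by_cases hab : au * bu = 1
    · have := hr.2 p ⟨hpred.1.1, by rw [e, hab, ofSyl_one, one_mul]⟩
      simp at this
    · have := hr.2 (⟨v, au * bu⟩ :: p) ⟨?_, by rw [e, wordProd_cons]⟩
      · simp at this
      · intro s hs
        rcases List.mem_cons.1 hs with rfl | hs
        · exact hab
        · exact hpred.1.1 s hs

theorem gp_map_cross (φ : (v : V) → G v → ℂ) (w : List ((v : V) × G v)) : ∀ x,
    (gpCross Γ G x w).Nodup →
    (gpCross Γ G x w).map (fun J => φ J.1 ((gpS Γ G J x)⁻¹ * gpS Γ G J (x * wordProd Γ G w))) =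
      w.map (fun s => φ s.1 s.2) := by
  induction w with
  | nil => intro x _; simp [gpCross]
  | cons c w ih =>
    intro x hnd
    rw [gpCross, List.nodup_cons] at hnd
    have h0 : gpS Γ G (gpJ Γ G x c.1) (x * wordProd Γ G (c :: w)) =
        @HMul.hMul (G c.1) (G c.1) (G c.1) _ (gpS Γ G (gpJ Γ G x c.1) x) c.2 := by
      rw [wordProd_cons, ← mul_assoc, gpS_not_cross Γ G _ _ _ hnd.1]
      exact gpS_same Γ G x c.1 c.2
    rw [gpCross, List.map_cons, List.map_cons]
    congr 1
    · refine (congrArg (fun t : G c.1 => φ c.1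
        (@HMul.hMul (G c.1) (G c.1) (G c.1) _ (@Inv.inv (G c.1) _ (gpS Γ G (gpJ Γ G x c.1) x)) t)) h0).trans ?_
      exact congrArg (φ c.1) (inv_mul_cancel_left _ _)
    · rw [← ih _ hnd.2]
      apply List.map_congr_left
      intro J hJ
      have : J ≠ gpJ Γ G x c.1 := fun h => hnd.1 (h ▸ hJ)
      rw [gpS_ne Γ G x c J this, wordProd_cons, mul_assoc]

theorem gp_finprod (φ : (v : V) → G v → ℂ) (he : ∀ v, φ v 1 = 1) (w : List ((v : V) × G v))
    (x : GraphProduct Γ G) (hnd : (gpCross Γ G x w).Nodup) :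
    ∏ᶠ J : GpHyp Γ G, φ J.1 ((gpS Γ G J x)⁻¹ * gpS Γ G J (x * wordProd Γ G w)) =
      (w.map (fun s => φ s.1 s.2)).prod := by
  classical
  rw [← gp_map_cross Γ G φ w x hnd, ← List.prod_toFinset _ hnd]
  apply finprod_eq_prod_of_mulSupport_subset
  intro J hJ
  simp only [List.coe_toFinset, Set.mem_ofPred_eq]
  by_contra hc
  apply hJ
  beta_reduce
  rw [gpS_not_cross Γ G J w x hc, inv_mul_cancel, he]

theorem gp_finite (g : GraphProduct Γ G) : {J | gpS Γ G J g ≠ 1}.Finite := by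
  classical
  obtain ⟨w, hw, rfl⟩ := gp_exists_word Γ G g
  refine (gpCross Γ G 1 w).toFinset.finite_toSet.subset ?_
  intro J hJ
  simp only [List.coe_toFinset, Set.mem_ofPred_eq]
  by_contra hc
  apply hJ
  have := gpS_not_cross Γ G J w 1 hc
  rw [one_mul, gpS_one] at this
  exact this

/-- tail set -/
def gpT (d : ℕ) (g : GraphProduct Γ G) : Set (GpHyp Γ G) :=
  {J | gpS Γ G J g ≠ 1 ∧ gpReach Γ G d g J}

theorem gpT_finite (d : ℕ) (g : GraphProduct Γ G) : (gpT Γ G d g).Finite :=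
  (gp_finite Γ G g).subset (fun _ h => h.1)

theorem le_kappa [Fintype V] (s : Finset V) (hs : Γ.IsClique s) : s.card ≤ kappa Γ := by
  apply le_csSup
  · refine ⟨Fintype.card V, ?_⟩
    rintro n ⟨t, ht⟩
    rw [← ht.2]
    exact Finset.card_le_univ t
  · exact ⟨s, hs, rfl⟩

theorem gpT_card [Fintype V] (d : ℕ) (g : GraphProduct Γ G) :
    (gpT_finite Γ G d g).toFinset.card ≤ d * kappa Γ := by
  classical
  let ℓ : GpHyp Γ G → ℕ := fun J => sInf {n | gpReach Γ G n g J}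
  have hℓ : ∀ J n, gpReach Γ G n g J → gpReach Γ G (ℓ J) g J ∧ ℓ J ≤ n := fun J n h =>
    ⟨Nat.sInf_mem (s := {n | gpReach Γ G n g J}) ⟨n, h⟩, Nat.sInf_le h⟩
  have h := Finset.card_le_mul_card_image_of_maps_to (f := ℓ) (s := (gpT_finite Γ G d g).toFinset)
    (t := Finset.Icc 1 d) ?_ (kappa Γ) ?_
  · simpa [mul_comm] using h
  · intro J hJ
    rw [Set.Finite.mem_toFinset] at hJ
    obtain ⟨h1, h2⟩ := hℓ J d hJ.2
    rw [Finset.mem_Icc]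
    refine ⟨?_, h2⟩
    by_contra h0
    obtain ⟨w, hw, hw'⟩ := h1
    have : w = [] := List.length_eq_zero_iff.1 (by omega)
    subst this
    simp [wordProd_nil] at hw'
  · intro n _
    have hadj : ∀ J ∈ (gpT_finite Γ G d g).toFinset.filter (fun a => ℓ a = n),
        ∀ J' ∈ (gpT_finite Γ G d g).toFinset.filter (fun a => ℓ a = n), J ≠ J' → Γ.Adj J.1 J'.1 := by
      intro J hJ J' hJ' hne
      rw [Finset.mem_filter, Set.Finite.mem_toFinset] at hJ hJ'
      by_contra hadj
      have hr := (hℓ J d hJ.1.2).1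
      have hr' := (hℓ J' d hJ'.1.2).1
      rcases gp_level Γ G J J' hne hadj g hJ.1.1 hJ'.1.1 with h | h
      · obtain ⟨m, hm, hm'⟩ := h _ hr'
        have := (hℓ J m hm').2
        omega
      · obtain ⟨m, hm, hm'⟩ := h _ hr
        have := (hℓ J' m hm').2
        omega
    rw [← Finset.card_image_of_injOn (f := Sigma.fst)]
    · apply le_kappa
      intro v hv v' hv' hne
      rw [Finset.mem_coe, Finset.mem_image] at hv hv'
      obtain ⟨J, hJ, rfl⟩ := hv
      obtain ⟨J', hJ', rfl⟩ := hv'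
      exact hadj J hJ J' hJ' (fun h => hne (by rw [h]))
    · intro J hJ J' hJ' he
      by_contra hne
      have := hadj J hJ J' hJ' hne
      rw [he] at this
      exact Γ.irrefl this

theorem gp_exists_red (g : GraphProduct Γ G) : ∃ w, IsReducedWordOf Γ G w g ∧
    w.length = redLength Γ G g := by
  have hne : {n | ∃ w, IsWordOf Γ G w g ∧ w.length = n}.Nonempty := by
    obtain ⟨w, hw⟩ := gp_exists_word Γ G g
    exact ⟨_, w, hw, rfl⟩
  obtain ⟨w, hw, hl⟩ := Nat.sInf_mem hne
  refine ⟨w, ⟨hw, ?_⟩, hl⟩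
  intro w' hw'
  rw [hl]
  exact Nat.sInf_le ⟨w', hw', rfl⟩

theorem gp_word_inv (w : List ((v : V) × G v)) : ∃ w' : List ((v : V) × G v),
    w'.length = w.length ∧ wordProd Γ G w' = (wordProd Γ G w)⁻¹ := by
  refine ⟨(w.map (fun s => ⟨s.1, s.2⁻¹⟩)).reverse, by simp, ?_⟩
  induction w with
  | nil => simp [wordProd_nil]
  | cons c w ih =>
    rw [List.map_cons, List.reverse_cons, wordProd_append, ih, wordProd_cons, wordProd_cons,
      wordProd_nil, mul_inv_rev, ofSyl_inv, mul_one]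

end GP5

section Statements

variable {V : Type} [Fintype V] (Γ : SimpleGraph V) (G : V → Type) [∀ v, Group (G v)]

theorem stmt17 (ε : ℝ) (hε : 0 < ε) (hε1 : ε < 1)
    (φ : (v : V) → G v → ℂ)
    (hcb : ∀ v, ∃ C, C < 1 + ε ∧ HasCBNormBound (φ v) C)
    (he : ∀ v, φ v 1 = 1) (d : ℕ) :
    ∃ φd : GraphProduct Γ G → GraphProduct Γ G → ℂ,
      HasCBKernelBound φd ((1 + 129 * Real.sqrt ε) ^ (d * kappa Γ)) ∧
      (∀ (g : GraphProduct Γ G) (w : List ((v : V) × G v)),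
        IsReducedWordOf Γ G w g → w.length = d →
        φd g 1 = (w.map (fun s => φ s.1 s.2)).prod) ∧
      (∀ g h : GraphProduct Γ G, redLength Γ G (h⁻¹ * g) = d →
        φd g h = φd (h⁻¹ * g) 1) := by
  classical
  choose H i1 i2 α β γ ξ hξ hγ hαβ hαξ hξβ hαγ hγβ hα hβ using
    fun v => gp_vertex (φ v) ε hε hε1 (hcb v) (he v)
  let s := gpS Γ G
  let T := gpT Γ G d
  let vec : ∀ J : GpHyp Γ G, GraphProduct Γ G × Bool → H J.1 := fun J x =>
    if s J x.1 = 1 then ξ J.1 else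
      if J ∈ T x.1 then (if x.2 then α J.1 (s J x.1) else β J.1 (s J x.1)) else γ J.1 (s J x.1)
  obtain ⟨K, j1, j2, A, hA⟩ := gp_tensor (fun J : GpHyp Γ G => H J.1) (fun J => ξ J.1)
    (fun J => hξ J.1) vec (fun x => (gp_finite Γ G x.1).subset (by
      intro J hJ hs
      apply hJ
      simp only [vec]
      exact if_pos hs))
  have hC : (1 : ℝ) ≤ 1 + 129 * Real.sqrt ε := by
    have := Real.sqrt_nonneg ε
    linarith
  have hnorm : ∀ x, ‖A x‖ ^ 2 ≤ (1 + 129 * Real.sqrt ε) ^ (d * kappa Γ) := by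
    intro x
    have h1 : ((‖A x‖ ^ 2 : ℝ) : ℂ) = ∏ᶠ J, ((‖vec J x‖ ^ 2 : ℝ) : ℂ) := by
      have := hA x x
      simp only [inner_self_eq_norm_sq_to_K] at this
      push_cast
      exact this
    have h2 : ∏ᶠ J, ((‖vec J x‖ ^ 2 : ℝ) : ℂ) =
        ∏ J ∈ (gpT_finite Γ G d x.1).toFinset, ((‖vec J x‖ ^ 2 : ℝ) : ℂ) := by
      apply finprod_eq_prod_of_mulSupport_subset
      intro J hJ
      rw [Set.Finite.coe_toFinset]
      by_contra hc
      apply hJ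
      have : ‖vec J x‖ = 1 := by
        simp only [vec]
        split_ifs with h
        · exact hξ _
        · exact hγ _ _
      simp [this]
    rw [h2, ← Complex.ofReal_prod] at h1
    rw [Complex.ofReal_inj.1 h1]
    calc _ ≤ ∏ J ∈ (gpT_finite Γ G d x.1).toFinset, (1 + 129 * Real.sqrt ε) := by
          apply Finset.prod_le_prod
          · intros; positivity
          · intro J _
            simp only [vec]
            split_ifs with h h'
            · rw [hξ]; simpa using hC
            · exact hα _ _
            · exact hβ _ _
            · rw [hγ]; simpa using hC
      _ = (1 + 129 * Real.sqrt ε) ^ (gpT_finite Γ G d x.1).toFinset.card := by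
          rw [Finset.prod_const]
      _ ≤ _ := pow_le_pow_right₀ hC (gpT_card Γ G d x.1)
  have key : ∀ g h w, IsReducedWordOf Γ G w (h⁻¹ * g) → w.length = d →
      inner ℂ (A (g, true)) (A (h, false)) = (w.map (fun s => φ s.1 s.2)).prod := by
    intro g h w hw hl
    have hwp : h * wordProd Γ G w = g := by rw [hw.1.2]; simp
    have hred : IsReducedWordOf Γ G w (wordProd Γ G w) := by
      rw [hw.1.2]; exact hw
    rw [hA, ← gp_finprod Γ G φ he w h (gpCross_nodup Γ G w h hred), hwp]
    apply finprod_congr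
    intro J
    obtain ⟨w', hl', hw'⟩ := gp_word_inv Γ G w
    have hwp' : g * wordProd Γ G w' = h := by rw [hw', ← hwp]; simp
    have hTh : s J h ≠ 1 → s J h ≠ s J g → J ∈ T h := by
      intro h1 h2
      refine ⟨h1, w, hl.le, ?_⟩
      rw [hwp]; exact h2.symm
    have hTg : s J g ≠ 1 → s J h ≠ s J g → J ∈ T g := by
      intro h1 h2
      refine ⟨h1, w', (hl'.trans hl).le, ?_⟩
      rw [hwp']; exact h2
    change inner ℂ (vec J (g, true)) (vec J (h, false)) = φ J.1 ((s J h)⁻¹ * s J g)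
    simp only [vec, if_true, Bool.false_eq_true, if_false]
    by_cases hg1 : s J g = 1
    · rw [if_pos hg1]
      by_cases hh1 : s J h = 1
      · rw [if_pos hh1, inner_self_eq_norm_sq_to_K, hξ, hg1, hh1]
        simp [he]
      · rw [if_neg hh1, if_pos (hTh hh1 (by rw [hg1]; exact hh1)), hξβ, hg1, mul_one]
    · rw [if_neg hg1]
      by_cases hh1 : s J h = 1
      · rw [if_pos hh1, if_pos (hTg hg1 (by rw [hh1]; exact Ne.symm hg1)), hαξ, hh1, inv_one, one_mul]
      · rw [if_neg hh1]
        by_cases hgh : s J h = s J g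
        · rw [hgh, inv_mul_cancel, he]
          split_ifs
          · rw [hαβ, inv_mul_cancel, he]
          · exact hαγ _ _
          · exact hγβ _ _
          · rw [inner_self_eq_norm_sq_to_K, hγ]; simp
        · rw [if_pos (hTh hh1 hgh), if_pos (hTg hg1 hgh), hαβ]
  refine ⟨fun g h => inner ℂ (A (g, true)) (A (h, false)), ?_, ?_, ?_⟩
  · refine ⟨K, j1, j2, fun g => A (g, true), fun h => A (h, false),
      Real.sqrt ((1 + 129 * Real.sqrt ε) ^ (d * kappa Γ)),
      Real.sqrt ((1 + 129 * Real.sqrt ε) ^ (d * kappa Γ)), ?_, ?_, ?_, fun _ _ => rfl⟩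
    · intro g; exact Real.le_sqrt_of_sq_le (hnorm _)
    · intro g; exact Real.le_sqrt_of_sq_le (hnorm _)
    · rw [Real.mul_self_sqrt (by positivity)]
  · intro g w hw hl
    exact key g 1 w (by simpa using hw) hl
  · intro g h hd
    obtain ⟨w, hw, hl⟩ := gp_exists_red Γ G (h⁻¹ * g)
    have h1 := key g h w hw (hl.trans hd)
    have h2 := key (h⁻¹ * g) 1 w (by simpa using hw) (hl.trans hd)
    exact h1.trans h2.symm

end Statements
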